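/- For every integer m ≥ 1, the polynomial Q(2^{2m}−2)(x) is congruent to 1 + 2·S_{2m−1}(x) modulo 4, i.e. every coefficient of the difference is divisible by 4. -/

import Mathlib

open Polynomial

/-- The Thue–Morse ±1 sequence: t 0 = 1, t (2n) = t n, t (2n+1) = -t n. -/
def tmSeq : ℕ → ℤ
  | 0 => 1
  | n + 1 => if (n + 1) % 2 = 0 then tmSeq ((n + 1) / 2) else -tmSeq ((n + 1) / 2)
decreasing_by all_goals exact Nat.div_lt_self (Nat.succ_pos n) one_lt_two

/-- Numerators of the convergents of the Thue–Morse continued fraction. -/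
noncomputable def Ptm : ℕ → ℤ[X]
  | 0 => 1
  | 1 => 1
  | n + 2 => Ptm (n + 1) + C (tmSeq (n + 2)) * X * Ptm n

/-- Denominators of the convergents of the Thue–Morse continued fraction. -/
noncomputable def Qtm : ℕ → ℤ[X]
  | 0 => 1
  | 1 => 1 - X
  | n + 2 => Qtm (n + 1) + C (tmSeq (n + 2)) * X * Qtm n

/-- S_m(x) = Σ_{j<m} x^(2^j). -/
noncomputable def Spoly (m : ℕ) : ℤ[X] := ∑ j ∈ Finset.range m, X ^ (2 ^ j)
/-- S^e_m(x) = Σ_{j<m} x^(2^(2j)). -/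
noncomputable def SePoly (m : ℕ) : ℤ[X] := ∑ j ∈ Finset.range m, X ^ (2 ^ (2 * j))
/-- S^o_m(x) = Σ_{j<m} x^(2^(2j+1)). -/
noncomputable def SoPoly (m : ℕ) : ℤ[X] := ∑ j ∈ Finset.range m, X ^ (2 ^ (2 * j + 1))

lemma tmSeq_two_mul (n : ℕ) : tmSeq (2 * n) = tmSeq n := by
  rcases n with _ | n
  · rfl
  · rw [show 2 * (n + 1) = (2 * n + 1) + 1 by ring, tmSeq, if_pos (by omega)]
    congr 1
    omega

lemma tmSeq_two_mul_add_one (n : ℕ) : tmSeq (2 * n + 1) = -tmSeq n := by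
  rw [tmSeq, if_neg (by omega)]
  congr 2
  omega

section Transfer

variable {R : Type*} [CommRing R]

/-- The transfer matrix across a Thue–Morse block of length `2 ^ k` whose first partial
numerator is `y`. -/
def tmTransfer (y : R) : ℕ → Matrix (Fin 2) (Fin 2) R
  | 0 => !![1, y; 1, 0]
  | k + 1 => tmTransfer (-y) k * tmTransfer y k

lemma tmTransfer_mulVec (x : R) (u : ℕ → R)
    (hu : ∀ n, u (n + 2) = u (n + 1) + (tmSeq n : R) * x * u n) (k n : ℕ) :
    Matrix.mulVec (tmTransfer ((tmSeq n : R) * x) k) ![u (2 ^ k * n + 1), u (2 ^ k * n)] =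
      ![u (2 ^ k * (n + 1) + 1), u (2 ^ k * (n + 1))] := by
  induction k generalizing n with
  | zero =>
    ext i
    fin_cases i <;> simp [tmTransfer, Matrix.mulVec, dotProduct, Fin.sum_univ_two, hu]
  | succ k ih =>
    have h₀ := ih (2 * n)
    have h₁ := ih (2 * n + 1)
    rw [tmSeq_two_mul] at h₀
    rw [tmSeq_two_mul_add_one, Int.cast_neg, neg_mul] at h₁
    rw [tmTransfer, ← Matrix.mulVec_mulVec, show 2 ^ (k + 1) * n = 2 ^ k * (2 * n) by ring, h₀, h₁,
      show 2 ^ (k + 1) * (n + 1) = 2 ^ k * (2 * n + 1 + 1) by ring]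

/-- In characteristic dividing `4`, the entries of the two complementary transfer matrices of
length `2 ^ (k + 2)` differ by a fixed matrix, and their trace and determinant are explicit. -/
lemma tmTransfer_relations (h4 : (4 : R) = 0) (x : R) (k : ℕ) :
    (tmTransfer (-x) (k + 2) 0 0 = tmTransfer x (k + 2) 0 0 + 2 * x ∧
      tmTransfer (-x) (k + 2) 0 1 = tmTransfer x (k + 2) 0 1 + 2 * x ∧
      tmTransfer (-x) (k + 2) 1 0 = tmTransfer x (k + 2) 1 0 ∧
      tmTransfer (-x) (k + 2) 1 1 = tmTransfer x (k + 2) 1 1 + 2 * x) ∧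
    tmTransfer x (k + 2) 0 0 + tmTransfer x (k + 2) 1 1 = 1 + 2 * x ^ 2 ^ (k + 1) ∧
    tmTransfer x (k + 2) 0 0 * tmTransfer x (k + 2) 1 1 -
      tmTransfer x (k + 2) 0 1 * tmTransfer x (k + 2) 1 0 = (x ^ 2 ^ (k + 1)) ^ 2 ∧
    2 * tmTransfer x (k + 2) 1 0 = 2 := by
  induction k with
  | zero =>
    simp only [tmTransfer, Matrix.mul_apply, Fin.sum_univ_two, Matrix.of_apply, Matrix.cons_val',
      Matrix.cons_val_zero, Matrix.cons_val_one, Matrix.cons_val_fin_one, neg_neg]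
    refine ⟨⟨?_, ?_, ?_, ?_⟩, ?_, ?_, ?_⟩ <;> grind
  | succ k ih =>
    rw [show k + 1 + 2 = (k + 2) + 1 by ring]
    simp only [tmTransfer.eq_2 _ (k + 2), Matrix.mul_apply, Fin.sum_univ_two, neg_neg]
    rw [pow_succ 2 (k + 1), pow_mul]
    generalize x ^ 2 ^ (k + 1) = p at *
    generalize tmTransfer x (k + 2) = A at *
    generalize tmTransfer (-x) (k + 2) = B at *
    obtain ⟨⟨h₀₀, h₀₁, h₁₀, h₁₁⟩, hT, hD, hC⟩ := ih
    rw [h₀₀, h₀₁, h₁₀, h₁₁]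
    generalize A 0 0 = a at *
    generalize A 0 1 = b at *
    generalize A 1 0 = c at *
    generalize A 1 1 = d at *
    clear h₀₀ h₀₁ h₁₀ h₁₁
    refine ⟨⟨?_, ?_, ?_, ?_⟩, ?_, ?_, ?_⟩ <;> grind

lemma tmTransfer_succ_apply_one_zero (h4 : (4 : R) = 0) (x : R) (k : ℕ) :
    tmTransfer x (k + 3) 1 0 = tmTransfer x (k + 2) 1 0 + 2 * x + 2 * x ^ 2 ^ (k + 1) := by
  obtain ⟨⟨h₀₀, h₀₁, h₁₀, h₁₁⟩, hT, hD, hC⟩ := tmTransfer_relations h4 x k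
  rw [tmTransfer.eq_2 _ (k + 2), Matrix.mul_apply, Fin.sum_univ_two, h₁₀, h₁₁]
  linear_combination tmTransfer x (k + 2) 1 0 * hT + (x ^ 2 ^ (k + 1) + x) * hC

lemma tmTransfer_even_apply_one_zero (h4 : (4 : R) = 0) (x : R) (m : ℕ) :
    tmTransfer x (2 * m + 2) 1 0 = 1 + 2 * ∑ j ∈ Finset.range (2 * m + 1), x ^ 2 ^ j := by
  induction m with
  | zero =>
    simp only [tmTransfer, Matrix.mul_apply, Fin.sum_univ_two, Matrix.of_apply, Matrix.cons_val',
      Matrix.cons_val_zero, Matrix.cons_val_one, Matrix.cons_val_fin_one, neg_neg]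
    simp
    grind
  | succ m ih =>
    rw [show 2 * (m + 1) + 2 = (2 * m + 1) + 3 by ring, tmTransfer_succ_apply_one_zero h4,
      show 2 * m + 1 + 2 = 2 * m + 3 by ring, tmTransfer_succ_apply_one_zero h4, ih,
      show 2 * (m + 1) + 1 = 2 * m + 1 + 1 + 1 by ring, Finset.sum_range_succ _ (2 * m + 1 + 1),
      Finset.sum_range_succ _ (2 * m + 1)]
    linear_combination x * h4

end Transfer

/-- The denominators `Qtm`, extended backwards by two terms. -/
noncomputable def QtmShift : ℕ → ℤ[X]
  | 0 => 0
  | 1 => 1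
  | n + 2 => Qtm n

lemma QtmShift_add_two (n : ℕ) :
    QtmShift (n + 2) = QtmShift (n + 1) + C (tmSeq n) * X * QtmShift n := by
  match n with
  | 0 => simp [QtmShift, Qtm]
  | 1 =>
    have h : tmSeq 1 = -1 := by rw [tmSeq_two_mul_add_one 0, tmSeq]
    simp [QtmShift, Qtm, h, sub_eq_add_neg]
  | n + 2 => simp [QtmShift, Qtm]

/-- Q(2^(2m)−2)(x) ≡ 1 + 2·S_{2m−1}(x) (mod 4). -/
theorem Qtm_pow_even_sub_two_mod_four (m : ℕ) (hm : 1 ≤ m) :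
    ∀ k, (4 : ℤ) ∣ (Qtm (2 ^ (2 * m) - 2) - (1 + 2 * Spoly (2 * m - 1))).coeff k := by
  obtain ⟨m, rfl⟩ := Nat.exists_eq_add_of_le' hm
  have h4 : (4 : (ZMod 4)[X]) = 0 := by
    rw [← C_ofNat, show (OfNat.ofNat 4 : ZMod 4) = 0 from rfl, C_0]
  let φ : ℤ[X] →+* (ZMod 4)[X] := mapRingHom (Int.castRingHom (ZMod 4))
  have hu : ∀ n, φ (QtmShift (n + 2)) =
      φ (QtmShift (n + 1)) + (tmSeq n : (ZMod 4)[X]) * X * φ (QtmShift n) := by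
    intro n
    simp [φ, QtmShift_add_two]
  have key := congrFun (tmTransfer_mulVec X (fun n => φ (QtmShift n)) hu (2 * m + 2) 0) 1
  have h0 : tmSeq 0 = 1 := by rw [tmSeq]
  have hq : QtmShift (2 ^ (2 * m + 2)) = Qtm (2 ^ (2 * m + 2) - 2) := by
    obtain ⟨n, hn⟩ := Nat.exists_eq_add_of_le'
      (show 2 ≤ 2 ^ (2 * m + 2) from Nat.le_self_pow (by omega) 2)
    rw [hn]
    rfl
  have hval : φ (Qtm (2 ^ (2 * m + 2) - 2)) = tmTransfer X (2 * m + 2) 1 0 := by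
    rw [← hq]
    simpa [Matrix.mulVec, dotProduct, Fin.sum_univ_two, h0, QtmShift] using key.symm
  have hzero : φ (Qtm (2 ^ (2 * (m + 1)) - 2) - (1 + 2 * Spoly (2 * (m + 1) - 1))) = 0 := by
    rw [show 2 * (m + 1) = 2 * m + 2 by ring, show 2 * m + 2 - 1 = 2 * m + 1 by omega, map_sub,
      hval, tmTransfer_even_apply_one_zero h4, sub_eq_zero]
    simp [φ, Spoly, Polynomial.map_sum]
  intro k
  have hk := congrArg (fun p => coeff p k) hzero
  simp only [φ, coe_mapRingHom, coeff_map, coeff_zero, eq_intCast] at hk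
  exact (ZMod.intCast_zmod_eq_zero_iff_dvd _ 4).mp hk
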